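/- Let A be an n×n right-stochastic real matrix and let τ > 0 be arbitrary. Set B = I − τ(A − I). Then B is invertible, the matrix Q = B⁻¹ is right stochastic, and for all vectors x, x̂ ∈ ℝⁿ and all k ∈ ℕ, ‖B⁻ᵏ x − B⁻ᵏ x̂‖_∞ ≤ ‖x − x̂‖_∞; in particular the implicit Euler scheme B x^{(k+1)} = x^{(k)} is unconditionally stable for every step size τ > 0. -/

import Mathlib

open Matrix

/-- A real square matrix is *right stochastic* if all its entries are nonnegative
and each of its rows sums to 1. -/
def Matrix.IsRightStochastic {n : ℕ} (A : Matrix (Fin n) (Fin n) ℝ) : Prop :=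
  (∀ i j, 0 ≤ A i j) ∧ (∀ i, ∑ j, A i j = 1)

/-- `Matrix.IsRightStochastic` is membership in Mathlib's submonoid `rowStochastic`. -/
lemma Matrix.isRightStochastic_iff_mem_rowStochastic {n : ℕ} {A : Matrix (Fin n) (Fin n) ℝ} :
    A.IsRightStochastic ↔ A ∈ rowStochastic ℝ (Fin n) :=
  mem_rowStochastic_iff_sum.symm

/-- A right-stochastic matrix is a contraction for the sup norm. -/
lemma Matrix.IsRightStochastic.norm_mulVec_le {n : ℕ} {A : Matrix (Fin n) (Fin n) ℝ}
    (hA : A.IsRightStochastic) (v : Fin n → ℝ) : ‖A *ᵥ v‖ ≤ ‖v‖ := by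
  refine (pi_norm_le_iff_of_nonneg (norm_nonneg v)).2 fun i ↦ ?_
  calc ‖∑ j, A i j * v j‖ ≤ ∑ j, A i j * ‖v‖ := norm_sum_le_of_le _ fun j _ ↦ by
        rw [norm_mul, Real.norm_of_nonneg (hA.1 i j)]
        exact mul_le_mul_of_nonneg_left (norm_le_pi_norm v j) (hA.1 i j)
    _ = ‖v‖ := by rw [← Finset.sum_mul, hA.2 i, one_mul]

/-- Discrete minimum principle for the implicit Euler matrix `1 - τ • (A - 1)`. -/
lemma Matrix.IsRightStochastic.nonneg_of_nonneg_implicitEuler_mulVec {n : ℕ}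
    {A : Matrix (Fin n) (Fin n) ℝ} (hA : A.IsRightStochastic) {τ : ℝ} (hτ : 0 ≤ τ)
    {v : Fin n → ℝ} (hv : 0 ≤ (1 - τ • (A - 1)) *ᵥ v) : 0 ≤ v := by
  intro j
  have : Nonempty (Fin n) := ⟨j⟩
  obtain ⟨i, hi⟩ := Finite.exists_min v
  refine le_trans ?_ (hi j)
  have hmean : v i ≤ (A *ᵥ v) i :=
    calc v i = ∑ j, A i j * v i := by rw [← Finset.sum_mul, hA.2 i, one_mul]
      _ ≤ ∑ j, A i j * v j :=
        Finset.sum_le_sum fun j _ ↦ mul_le_mul_of_nonneg_left (hi j) (hA.1 i j)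
  have hvi : 0 ≤ v i - τ * ((A *ᵥ v) i - v i) := by
    simpa [sub_mulVec, smul_mulVec] using hv i
  have := mul_nonneg hτ (sub_nonneg.2 hmean)
  simp only [Pi.zero_apply]
  linarith

/-- The implicit Euler matrix of a right-stochastic matrix is invertible. -/
lemma Matrix.IsRightStochastic.isUnit_implicitEuler {n : ℕ}
    {A : Matrix (Fin n) (Fin n) ℝ} (hA : A.IsRightStochastic) {τ : ℝ} (hτ : 0 ≤ τ) :
    IsUnit (1 - τ • (A - 1)) := by
  rw [← mulVec_injective_iff_isUnit]
  intro v w hvw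
  have key {v w : Fin n → ℝ} (h : (1 - τ • (A - 1)) *ᵥ v = (1 - τ • (A - 1)) *ᵥ w) : w ≤ v :=
    sub_nonneg.1 <| hA.nonneg_of_nonneg_implicitEuler_mulVec hτ <| by
      rw [mulVec_sub, h, sub_self]
  exact le_antisymm (key hvw.symm) (key hvw)

/-- The inverse of the implicit Euler matrix of a right-stochastic matrix is right stochastic. -/
lemma Matrix.IsRightStochastic.inv_implicitEuler {n : ℕ}
    {A : Matrix (Fin n) (Fin n) ℝ} (hA : A.IsRightStochastic) {τ : ℝ} (hτ : 0 ≤ τ) :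
    (1 - τ • (A - 1))⁻¹.IsRightStochastic := by
  have hdet := (isUnit_iff_isUnit_det _).1 (hA.isUnit_implicitEuler hτ)
  rw [isRightStochastic_iff_mem_rowStochastic, mem_rowStochastic]
  constructor
  · intro i j
    have hcol : 0 ≤ (1 - τ • (A - 1))⁻¹ *ᵥ Pi.single j 1 := by
      apply hA.nonneg_of_nonneg_implicitEuler_mulVec hτ
      rw [mulVec_mulVec, mul_nonsing_inv _ hdet, one_mulVec]
      exact Pi.single_nonneg.2 zero_le_one
    simpa using hcol i
  · have hone : (1 - τ • (A - 1)) *ᵥ 1 = 1 := by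
      rw [sub_mulVec, smul_mulVec, sub_mulVec, one_mulVec,
        (mem_rowStochastic.1 (isRightStochastic_iff_mem_rowStochastic.1 hA)).2]
      simp
    calc (1 - τ • (A - 1))⁻¹ *ᵥ 1
        = (1 - τ • (A - 1))⁻¹ *ᵥ ((1 - τ • (A - 1)) *ᵥ 1) := by rw [hone]
      _ = 1 := by rw [mulVec_mulVec, nonsing_inv_mul _ hdet, one_mulVec]

/-- Unconditional stability of the implicit Euler scheme: for a right-stochastic
matrix `A` and *any* step size `τ > 0`, the matrix `B = I − τ(A − I)` is
invertible, `Q = B⁻¹` is right stochastic, and iterating `B⁻¹` never increases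
the sup-norm distance between two trajectories.  (The norm on `Fin n → ℝ` is the
sup norm.) -/
theorem implicit_euler_scheme_unconditionally_stable {n : ℕ}
    (A : Matrix (Fin n) (Fin n) ℝ) (hA : A.IsRightStochastic)
    (τ : ℝ) (hτ : 0 < τ) (B : Matrix (Fin n) (Fin n) ℝ)
    (hB : B = 1 - τ • (A - 1)) :
    IsUnit B ∧ (B⁻¹).IsRightStochastic ∧
      ∀ (x y : Fin n → ℝ) (k : ℕ),
        ‖(B⁻¹ ^ k) *ᵥ x - (B⁻¹ ^ k) *ᵥ y‖ ≤ ‖x - y‖ := by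
  subst hB
  have hQ := hA.inv_implicitEuler hτ.le
  refine ⟨hA.isUnit_implicitEuler hτ.le, hQ, fun x y k ↦ ?_⟩
  rw [← mulVec_sub]
  exact (isRightStochastic_iff_mem_rowStochastic.2
    (pow_mem (isRightStochastic_iff_mem_rowStochastic.1 hQ) k)).norm_mulVec_le _
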